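/- Let C = {(x, y) ∈ ℂ² : y² = x⁵} and C̃ = {(x, y) ∈ ℂ² : y² = x³}, as germs at 0. Then there is no bi-(4/5)-Hölder homeomorphism F : (C, 0) → (C̃, 0), i.e., no germ of homeomorphism F with F(0) = 0 such that both F and F⁻¹ satisfy ‖F(p) - F(q)‖ ≤ K‖p - q‖^{4/5} near 0. -/

import Mathlib

open Metric

/-- The curve `y² = x⁵` in `ℂ²`. -/
def curveC : Set (EuclideanSpace ℂ (Fin 2)) := {p | (p 1) ^ 2 = (p 0) ^ 5}

/-- The curve `y² = x³` in `ℂ²`. -/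
def curveCt : Set (EuclideanSpace ℂ (Fin 2)) := {p | (p 1) ^ 2 = (p 0) ^ 3}

/-- `(X,0)` and `(Y,0)` are bi-`α`-Hölder homeomorphic as germs. -/
def BiHolderGerm (X Y : Set (EuclideanSpace ℂ (Fin 2))) (α : ℝ) : Prop :=
  ∃ (U V : Set (EuclideanSpace ℂ (Fin 2))) (F : EuclideanSpace ℂ (Fin 2) → EuclideanSpace ℂ (Fin 2)) (c : ℝ),
    IsOpen U ∧ IsOpen V ∧ (0 : EuclideanSpace ℂ (Fin 2)) ∈ U ∧ (0 : EuclideanSpace ℂ (Fin 2)) ∈ V ∧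
    0 < c ∧ F 0 = 0 ∧ Set.BijOn F (X ∩ U) (Y ∩ V) ∧
    ∀ p ∈ X ∩ U, ∀ q ∈ X ∩ U,
      (1 / c) * ‖p - q‖ ^ (1 / α) ≤ ‖F p - F q‖ ∧ ‖F p - F q‖ ≤ c * ‖p - q‖ ^ α


lemma hp_conv (R : ℝ) : Convex ℝ {v : ℂ | v.re < R} := convex_halfSpace_re_lt R

lemma const_of_exp_one (R : ℝ) (f : ℂ → ℂ) (hf : ContinuousOn f {v : ℂ | v.re < R})
    (h : ∀ v : ℂ, v.re < R → Complex.exp (f v) = 1) :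
    ∃ n : ℤ, ∀ v : ℂ, v.re < R → f v = n * (2 * Real.pi * Complex.I) := by
  have hd : IsDiscrete (Set.range (fun n : ℤ => (n : ℂ))) := by
    exact Complex.isClosedEmbedding_intCast.isInducing.isDiscrete_range
  have hpi : (2 * Real.pi * Complex.I : ℂ) ≠ 0 := Complex.two_pi_I_ne_zero
  obtain ⟨y, ⟨n, rfl⟩, hy⟩ := (hp_conv R).isPreconnected.eqOn_const_of_mapsTo hd
    (f := fun v => f v / (2 * Real.pi * Complex.I)) (hf.div_const _) (by
      intro v hv
      obtain ⟨n, hn⟩ := Complex.exp_eq_one_iff.1 (h v hv)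
      exact ⟨n, by simp only [hn]; field_simp⟩) ⟨_, 0, rfl⟩
  refine ⟨n, fun v hv => ?_⟩
  have := hy hv
  simp only [Function.const_apply] at this
  rw [div_eq_iff hpi] at this
  exact this

lemma exists_lift (R : ℝ) (f : ℂ → ℂ) (hf : ContinuousOn f {v : ℂ | v.re < R})
    (h : ∀ v : ℂ, v.re < R → f v ≠ 0) :
    ∃ S : ℂ → ℂ, ContinuousOn S {v : ℂ | v.re < R} ∧
      ∀ v : ℂ, v.re < R → Complex.exp (S v) = f v := by
  have hne : ({v : ℂ | v.re < R}).Nonempty := ⟨((R - 1 : ℝ) : ℂ), by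
    simp only [Set.mem_ofPred_eq, Complex.ofReal_re]; linarith⟩
  have hsc : IsSimplyConnected {v : ℂ | v.re < R} := by
    have := (hp_conv R).contractibleSpace hne
    have : SimplyConnectedSpace {v : ℂ | v.re < R} := inferInstance
    exact this
  obtain ⟨S, hS, hS'⟩ := Complex.exists_continuousOn_eqOn_exp_comp hsc
    (isOpen_lt Complex.continuous_re continuous_const) hf (by
      rintro ⟨v, hv, h0⟩; exact h v hv h0)
  exact ⟨S, hS, fun v hv => hS' hv⟩

lemma core (s g : ℂ → ℂ) (r r' : ℝ) (hr : 0 < r) (hr' : 0 < r')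
    (hs : ContinuousOn s {t | t ≠ 0 ∧ ‖t‖ < r})
    (hs0 : ∀ t, t ≠ 0 → ‖t‖ < r → s t ≠ 0)
    (hsre : ∀ t, t ≠ 0 → ‖t‖ < r → 0 < (s (-t) / s t).re)
    (hg : ContinuousOn g {t | t ≠ 0 ∧ ‖t‖ < r'})
    (hg0 : ∀ z, z ≠ 0 → ‖z‖ < r' → g z ≠ 0)
    (hgr : ∀ z, z ≠ 0 → ‖z‖ < r' → ‖g z‖ < r)
    (hsg : ∀ z, z ≠ 0 → ‖z‖ < r' → s (g z) = z) : False := by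
  have hexp : ∀ ρ : ℝ, 0 < ρ → ∀ v : ℂ, ‖Complex.exp v‖ < ρ ↔ v.re < Real.log ρ := by
    intro ρ hρ v
    rw [Complex.norm_exp, Real.lt_log_iff_exp_lt hρ]
  have hmaps : ∀ ρ : ℝ, 0 < ρ → Set.MapsTo Complex.exp {v : ℂ | v.re < Real.log ρ}
      {t | t ≠ 0 ∧ ‖t‖ < ρ} := fun ρ hρ v hv => ⟨Complex.exp_ne_zero v, (hexp ρ hρ v).2 hv⟩
  obtain ⟨S, hSc, hS⟩ := exists_lift (Real.log r) (fun v => s (Complex.exp v))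
    (hs.comp Complex.continuous_exp.continuousOn (hmaps r hr))
    (fun v hv => hs0 _ (Complex.exp_ne_zero v) ((hexp r hr v).2 hv))
  obtain ⟨G, hGc, hG⟩ := exists_lift (Real.log r') (fun v => g (Complex.exp v))
    (hg.comp Complex.continuous_exp.continuousOn (hmaps r' hr'))
    (fun v hv => hg0 _ (Complex.exp_ne_zero v) ((hexp r' hr' v).2 hv))
  have hpi : (2 * Real.pi * Complex.I : ℂ) ≠ 0 := Complex.two_pi_I_ne_zero
  -- translations
  have hre : ∀ (v : ℂ) (n : ℤ), (v + n * (2 * Real.pi * Complex.I)).re = v.re := by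
    intro v n; simp
  have hre1 : ∀ (v : ℂ), (v + Real.pi * Complex.I).re = v.re := by
    intro v; simp
  have hperS : ∀ v : ℂ, s (Complex.exp (v + Real.pi * Complex.I)) = s (-Complex.exp v) := by
    intro v; rw [Complex.exp_add, Complex.exp_pi_mul_I]; simp
  -- half translation
  have hcT : ContinuousOn (fun v => S (v + Real.pi * Complex.I)) {v : ℂ | v.re < Real.log r} :=
    hSc.comp (by fun_prop) (fun v hv => by
      simp only [Set.mem_ofPred_eq] at hv ⊢; rw [hre1]; exact hv)
  have hq : ∀ v : ℂ, v.re < Real.log r →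
      Complex.exp (S (v + Real.pi * Complex.I) - S v) = s (-Complex.exp v) / s (Complex.exp v) := by
    intro v hv
    rw [Complex.exp_sub, hS v hv, hS _ (by rw [hre1]; exact hv), hperS]
  have hqre : ∀ v : ℂ, v.re < Real.log r →
      0 < (Complex.exp (S (v + Real.pi * Complex.I) - S v)).re := by
    intro v hv
    rw [hq v hv]
    exact hsre _ (Complex.exp_ne_zero v) ((hexp r hr v).2 hv)
  obtain ⟨k, hk⟩ := const_of_exp_one (Real.log r)
    (fun v => (S (v + Real.pi * Complex.I) - S v)
      - Complex.log (Complex.exp (S (v + Real.pi * Complex.I) - S v)))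
    ((hcT.sub hSc).sub (ContinuousOn.clog (Complex.continuous_exp.comp_continuousOn (hcT.sub hSc))
      (fun v hv => Or.inl (hqre v hv))))
    (fun v hv => by
      rw [Complex.exp_sub, Complex.exp_log (Complex.exp_ne_zero _), div_self (Complex.exp_ne_zero _)])
  have hper2 : ∀ v : ℂ, s (Complex.exp (v + 2 * Real.pi * Complex.I)) = s (Complex.exp v) := by
    intro v; rw [Complex.exp_add, Complex.exp_two_pi_mul_I, mul_one]
  have hfull : ∀ v : ℂ, v.re < Real.log r →
      S (v + 2 * Real.pi * Complex.I) = S v + (2 * k : ℤ) * (2 * Real.pi * Complex.I) := by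
    intro v hv
    have hv1 : (v + Real.pi * Complex.I).re < Real.log r := by rw [hre1]; exact hv
    have e2 : v + Real.pi * Complex.I + Real.pi * Complex.I = v + 2 * Real.pi * Complex.I := by ring
    have hv2 : (v + 2 * Real.pi * Complex.I).re < Real.log r := by rw [← e2, hre1]; exact hv1
    have h1 := hk v hv
    have h2 := hk _ hv1
    have p1 := hqre v hv
    have p2 := hqre _ hv1
    simp only [e2] at h2 p2
    have a1 := abs_lt.1 (Complex.abs_arg_lt_pi_div_two_iff.2 (Or.inl p1))
    have a2 := abs_lt.1 (Complex.abs_arg_lt_pi_div_two_iff.2 (Or.inl p2))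
    rw [← Complex.log_im] at a1 a2
    have : Complex.exp (S (v + 2 * Real.pi * Complex.I) - S v) = 1 := by
      rw [Complex.exp_sub, hS v hv, hS _ hv2, hper2, div_self]
      exact hs0 _ (Complex.exp_ne_zero v) ((hexp r hr v).2 hv)
    obtain ⟨m, hm⟩ := Complex.exp_eq_one_iff.1 this
    set L1 := Complex.log (Complex.exp (S (v + Real.pi * Complex.I) - S v))
    set L2 := Complex.log (Complex.exp
      (S (v + 2 * Real.pi * Complex.I) - S (v + Real.pi * Complex.I)))
    have hL : L1 + L2 = ((m - 2 * k : ℤ) : ℂ) * (2 * Real.pi * Complex.I) := by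
      push_cast
      linear_combination hm - h1 - h2
    have him := congrArg Complex.im hL
    have : (((m - 2 * k : ℤ) : ℂ) * (2 * Real.pi * Complex.I)).im
        = ((m - 2 * k : ℤ) : ℝ) * (2 * Real.pi) := by
      simp
    rw [this, Complex.add_im] at him
    have hpp := Real.pi_pos
    have hz : m - 2 * k = 0 := by
      have l1 : ((m - 2 * k : ℤ) : ℝ) < 1 := by nlinarith
      have l2 : (-1 : ℝ) < ((m - 2 * k : ℤ) : ℝ) := by nlinarith
      have l1' : m - 2 * k < 1 := by exact_mod_cast l1
      have l2' : -1 < m - 2 * k := by exact_mod_cast l2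
      omega
    have hm2 : m = 2 * k := by omega
    rw [← hm2]
    linear_combination hm
  have hiter : ∀ (n : ℕ) (v : ℂ), v.re < Real.log r →
      S (v + n * (2 * Real.pi * Complex.I)) = S v + n * ((2 * k : ℤ) * (2 * Real.pi * Complex.I)) := by
    intro n
    induction n with
    | zero => intro v hv; simp
    | succ n ih =>
      intro v hv
      have := hfull (v + n * (2 * Real.pi * Complex.I)) (by
        have := hre v n; push_cast at this; rw [this]; exact hv)
      rw [ih v hv] at this
      rw [show v + ((n + 1 : ℕ) : ℂ) * (2 * Real.pi * Complex.I)
        = v + n * (2 * Real.pi * Complex.I) + 2 * Real.pi * Complex.I by push_cast; ring, this]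
      push_cast; ring
  have hiterZ : ∀ (n : ℤ) (v : ℂ), v.re < Real.log r →
      S (v + n * (2 * Real.pi * Complex.I)) = S v + n * ((2 * k : ℤ) * (2 * Real.pi * Complex.I)) := by
    intro n v hv
    obtain ⟨m, rfl | rfl⟩ := n.eq_nat_or_neg
    · exact_mod_cast hiter m v hv
    · have := hiter m (v + ((-m : ℤ) : ℂ) * (2 * Real.pi * Complex.I)) (by rw [hre]; exact hv)
      rw [show v + ((-m : ℤ) : ℂ) * (2 * Real.pi * Complex.I) + m * (2 * Real.pi * Complex.I) = v by
        push_cast; ring] at this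
      rw [this]; push_cast; ring
  have hGre : ∀ w : ℂ, w.re < Real.log r' → (G w).re < Real.log r := by
    intro w hw
    rw [← hexp r hr, hG w hw]
    exact hgr _ (Complex.exp_ne_zero w) ((hexp r' hr' w).2 hw)
  obtain ⟨j, hj⟩ := const_of_exp_one (Real.log r') (fun w => S (G w) - w)
    ((hSc.comp hGc hGre).sub continuousOn_id) (fun w hw => by
      rw [Complex.exp_sub, hS _ (hGre w hw), hG w hw,
        hsg _ (Complex.exp_ne_zero w) ((hexp r' hr' w).2 hw), div_self (Complex.exp_ne_zero _)])
  set w : ℂ := ((Real.log r' - 1 : ℝ) : ℂ) with hw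
  have hw1 : w.re < Real.log r' := by rw [hw, Complex.ofReal_re]; linarith
  have hw2 : (w + 2 * Real.pi * Complex.I).re < Real.log r' := by
    have := hre w 1
    simp only [Int.cast_one, one_mul] at this
    rw [this]; exact hw1
  have : Complex.exp (G (w + 2 * Real.pi * Complex.I) - G w) = 1 := by
    rw [Complex.exp_sub, hG _ hw1, hG _ hw2, Complex.exp_add, Complex.exp_two_pi_mul_I, mul_one,
      div_self (hg0 _ (Complex.exp_ne_zero w) ((hexp r' hr' w).2 hw1))]
  obtain ⟨n, hn⟩ := Complex.exp_eq_one_iff.1 this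
  have h3 := hiterZ n (G w) (hGre w hw1)
  rw [← hn, add_sub_cancel] at h3
  have h4 := hj w hw1
  have h5 := hj _ hw2
  have h6 : (1 : ℂ) * (2 * Real.pi * Complex.I)
      = ((n * (2 * k) : ℤ) : ℂ) * (2 * Real.pi * Complex.I) := by
    push_cast at h3 ⊢
    linear_combination h3 - h5 + h4
  have h7 := mul_right_cancel₀ hpi h6
  have h8 : (1 : ℤ) = n * (2 * k) := by exact_mod_cast h7
  have h9 : (1 : ℤ) = 2 * (n * k) := by rw [h8]; ring
  omega

abbrev E2 := EuclideanSpace ℂ (Fin 2)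

lemma e2_norm_le (p : E2) : ‖p‖ ≤ ‖p 0‖ + ‖p 1‖ := by
  rw [EuclideanSpace.norm_eq, Fin.sum_univ_two]
  apply Real.sqrt_le_iff.2
  constructor
  · positivity
  · nlinarith [norm_nonneg (p 0), norm_nonneg (p 1)]

/-- Closeness of ratio. -/
lemma ratio_re (a b : ℂ) (ha : a ≠ 0) (d : ℝ) (h2 : ‖a ^ 2 - b ^ 2‖ ≤ d) (h3 : ‖a ^ 3 - b ^ 3‖ ≤ d)
    (ha1 : ‖a‖ ≤ 1) (hd : 4 * d ≤ ‖a‖ ^ 3) : 0 < (b / a).re := by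
  have hapos : 0 < ‖a‖ := norm_pos_iff.2 ha
  set ρ := b / a with hρ
  have hb : b = ρ * a := by rw [hρ]; field_simp
  have e2 : ‖1 - ρ ^ 2‖ * ‖a‖ ^ 2 ≤ d := by
    rw [← norm_pow, ← norm_mul]
    convert h2 using 2
    rw [hb]; ring
  have e3 : ‖1 - ρ ^ 3‖ * ‖a‖ ^ 3 ≤ d := by
    rw [← norm_pow, ← norm_mul]
    convert h3 using 2
    rw [hb]; ring
  have hle : ‖a‖ ^ 3 ≤ ‖a‖ ^ 2 := pow_le_pow_of_le_one hapos.le ha1 (by norm_num)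
  have p2 : 0 < ‖a‖ ^ 2 := by positivity
  have p3 : 0 < ‖a‖ ^ 3 := by positivity
  have f2 : ‖1 - ρ ^ 2‖ ≤ 1 / 4 := by
    by_contra! h
    nlinarith
  have f3 : ‖1 - ρ ^ 3‖ ≤ 1 / 4 := by
    by_contra! h
    nlinarith
  have hr2 : ‖ρ‖ ^ 2 ≤ 5 / 4 := by
    have : ‖ρ ^ 2‖ ≤ ‖(1 : ℂ)‖ + ‖1 - ρ ^ 2‖ := by
      have := norm_sub_le (1 : ℂ) (1 - ρ ^ 2)
      simpa using this
    rw [norm_pow, norm_one] at this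
    linarith
  have hr : ‖ρ‖ ≤ 2 := by nlinarith [norm_nonneg ρ]
  have hfin : ‖1 - ρ‖ < 1 := by
    have : 1 - ρ = (1 - ρ ^ 3) - ρ * (1 - ρ ^ 2) := by ring
    rw [this]
    calc _ ≤ ‖1 - ρ ^ 3‖ + ‖ρ * (1 - ρ ^ 2)‖ := norm_sub_le _ _
      _ ≤ 1 / 4 + 2 * (1 / 4) := by
        rw [norm_mul]; gcongr
      _ < 1 := by norm_num
  have := (Complex.abs_re_le_norm (1 - ρ)).trans_lt hfin
  rw [Complex.sub_re, Complex.one_re] at this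
  linarith [(abs_lt.1 this).2]

lemma curveCt_fst_ne {p : E2} (hp : p ∈ curveCt) (h : p ≠ 0) : p 0 ≠ 0 := by
  intro h0
  have h1 : (p 1) ^ 2 = (p 0) ^ 3 := hp
  rw [h0] at h1
  apply h
  ext i
  fin_cases i
  · exact h0
  · simpa using h1

lemma curveC_fst_ne {p : E2} (hp : p ∈ curveC) (h : p ≠ 0) : p 0 ≠ 0 := by
  intro h0
  have h1 : (p 1) ^ 2 = (p 0) ^ 5 := hp
  rw [h0] at h1
  apply h
  ext i
  fin_cases i
  · exact h0
  · simpa using h1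

lemma cont_coord (i : Fin 2) : Continuous (fun p : E2 => p i) := by fun_prop

lemma contOn_of_bound {X : Set E2} (f : E2 → E2) (K β : ℝ) (hβ : 0 < β)
    (h : ∀ p ∈ X, ∀ q ∈ X, ‖f p - f q‖ ≤ (K * ‖p - q‖) ^ β) : ContinuousOn f X := by
  intro q hq
  rw [ContinuousWithinAt, tendsto_iff_norm_sub_tendsto_zero]
  have hc : Continuous (fun p : E2 => (K * ‖p - q‖) ^ β) := by
    apply Continuous.rpow_const
    · fun_prop
    · intro x; exact Or.inr hβ.le
  have ht : Filter.Tendsto (fun p : E2 => (K * ‖p - q‖) ^ β) (nhdsWithin q X) (nhds 0) := by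
    have := (hc.tendsto q).mono_left (nhdsWithin_le_nhds (s := X))
    simpa [Real.zero_rpow hβ.ne'] using this
  apply tendsto_of_tendsto_of_tendsto_of_le_of_le' tendsto_const_nhds ht
  · exact Filter.Eventually.of_forall fun p => norm_nonneg _
  · filter_upwards [self_mem_nhdsWithin] with p hp using h p hp q hq

lemma real_est (c τ σ A : ℝ) (hc : 0 < c) (hτ : 0 < τ) (hσ : 0 < σ) (hA : 0 ≤ A)
    (hA4 : A ^ 4 = τ ^ 10) (h1 : 1 / c * A ≤ 2 * σ ^ 2)
    (hsmall : (8 * c) ^ 8 * (2 * c) ^ 12 * τ ^ 2 ≤ 1) : 4 * (2 * c * τ ^ 4) ≤ σ ^ 3 := by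
  have h2 : A ≤ 2 * c * σ ^ 2 := by
    rw [one_div, inv_mul_le_iff₀ hc] at h1; linarith
  have h3 : τ ^ 30 ≤ (2 * c) ^ 12 * σ ^ 24 := by
    calc τ ^ 30 = (A ^ 4) ^ 3 := by rw [hA4]; ring
      _ = A ^ 12 := by ring
      _ ≤ (2 * c * σ ^ 2) ^ 12 := by gcongr
      _ = _ := by ring
  have h4 : (4 * (2 * c * τ ^ 4)) ^ 8 ≤ (σ ^ 3) ^ 8 := by
    calc (4 * (2 * c * τ ^ 4)) ^ 8 = (8 * c) ^ 8 * τ ^ 2 * τ ^ 30 := by ring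
      _ ≤ (8 * c) ^ 8 * τ ^ 2 * ((2 * c) ^ 12 * σ ^ 24) := by gcongr
      _ = ((8 * c) ^ 8 * (2 * c) ^ 12 * τ ^ 2) * σ ^ 24 := by ring
      _ ≤ 1 * σ ^ 24 := by gcongr
      _ = _ := by ring
  exact le_of_pow_le_pow_left₀ (by norm_num) (by positivity) h4

/-- There is no bi-`(4/5)`-Hölder homeomorphism between the germs at `0` of
`y² = x⁵` and `y² = x³`. -/
theorem no_biHolder_four_fifths : ¬ BiHolderGerm curveC curveCt (4 / 5) := by
  rintro ⟨U, V, F, c, hU, hV, hU0, hV0, hc, hF0, hbij, hH⟩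
  have e45 : (1 / (4 / 5) : ℝ) = 5 / 4 := by norm_num
  simp only [e45] at hH
  have h0C : (0 : E2) ∈ curveC ∩ U := ⟨by simp [curveC], hU0⟩
  have h0Ct : (0 : E2) ∈ curveCt ∩ V := ⟨by simp [curveCt], hV0⟩
  let γ : ℂ → E2 := fun t => !₂[t ^ 2, t ^ 5]
  let δ : ℂ → E2 := fun z => !₂[z ^ 2, z ^ 3]
  have γ0 : ∀ t, γ t 0 = t ^ 2 := fun t => by simp [γ]
  have γ1 : ∀ t, γ t 1 = t ^ 5 := fun t => by simp [γ]
  have δ0 : ∀ t, δ t 0 = t ^ 2 := fun t => by simp [δ]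
  have δ1 : ∀ t, δ t 1 = t ^ 3 := fun t => by simp [δ]
  have hγc : Continuous γ := by fun_prop
  have hδc : Continuous δ := by fun_prop
  have hγz : γ 0 = 0 := by ext i; fin_cases i <;> simp [γ]
  have hδz : δ 0 = 0 := by ext i; fin_cases i <;> simp [δ]
  have hγC : ∀ t, γ t ∈ curveC := fun t => by
    show (γ t 1) ^ 2 = (γ t 0) ^ 5
    rw [γ0, γ1]; ring
  have hδC : ∀ t, δ t ∈ curveCt := fun t => by
    show (δ t 1) ^ 2 = (δ t 0) ^ 3
    rw [δ0, δ1]; ring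
  -- continuity of `F` and of the inverse
  have hFc : ContinuousOn F (curveC ∩ U) := by
    apply contOn_of_bound F (c ^ (5 / 4 : ℝ)) (4 / 5) (by norm_num)
    intro p hp q hq
    refine (hH p hp q hq).2.trans (le_of_eq ?_)
    rw [Real.mul_rpow (by positivity) (by positivity), ← Real.rpow_mul hc.le]
    norm_num
  let Φ := Function.invFunOn F (curveC ∩ U)
  have hΦmem : ∀ a ∈ curveCt ∩ V, Φ a ∈ curveC ∩ U := fun a ha =>
    Function.invFunOn_mem (hbij.surjOn ha)
  have hΦF : ∀ a ∈ curveCt ∩ V, F (Φ a) = a := fun a ha =>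
    Function.invFunOn_eq (hbij.surjOn ha)
  have hΦ0 : Φ 0 = 0 := hbij.injOn (hΦmem 0 h0Ct) h0C (by rw [hΦF 0 h0Ct, hF0])
  have hΦc : ContinuousOn Φ (curveCt ∩ V) := by
    apply contOn_of_bound Φ c (4 / 5) (by norm_num)
    intro p hp q hq
    have := (hH _ (hΦmem p hp) _ (hΦmem q hq)).1
    rw [hΦF p hp, hΦF q hq, one_div, inv_mul_le_iff₀ hc] at this
    calc ‖Φ p - Φ q‖ = (‖Φ p - Φ q‖ ^ (5 / 4 : ℝ)) ^ (4 / 5 : ℝ) := by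
          rw [← Real.rpow_mul (norm_nonneg _)]; norm_num
      _ ≤ _ := by gcongr
  -- small radius
  have ev : ∀ᶠ t : ℂ in nhds 0, γ t ∈ U ∧ c * ‖γ t‖ ^ (4 / 5 : ℝ) < 1 ∧
      (8 * c) ^ 8 * (2 * c) ^ 12 * ‖t‖ ^ 2 < 1 := by
    refine (hγc.continuousAt.eventually (by rw [hγz]; exact hU.mem_nhds hU0)).and
      (Filter.Eventually.and ?_ ?_)
    · have hcc : Continuous (fun t => c * ‖γ t‖ ^ (4 / 5 : ℝ)) :=
        continuous_const.mul ((hγc.norm).rpow_const (fun _ => Or.inr (by norm_num)))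
      apply hcc.continuousAt.eventually_lt continuousAt_const
      rw [hγz, norm_zero, Real.zero_rpow (by norm_num)]; norm_num
    · have hcc : Continuous (fun t : ℂ => (8 * c) ^ 8 * (2 * c) ^ 12 * ‖t‖ ^ 2) := by fun_prop
      apply hcc.continuousAt.eventually_lt continuousAt_const
      simp
  obtain ⟨r, hr, hrb⟩ := Metric.eventually_nhds_iff.1 ev
  simp only [dist_zero_right] at hrb
  have hγU : ∀ t, ‖t‖ < r → γ t ∈ curveC ∩ U := fun t ht => ⟨hγC t, (hrb ht).1⟩
  have ev' : ∀ᶠ z : ℂ in nhds 0, δ z ∈ V := 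
    hδc.continuousAt.eventually (by rw [hδz]; exact hV.mem_nhds hV0)
  have ev2 : ∀ᶠ z : ℂ in nhds 0, ‖Φ (δ z)‖ < r ^ 2 := by
    have h1 : ContinuousWithinAt (fun z => Φ (δ z)) (δ ⁻¹' V) 0 := by
      have hco : ContinuousOn (fun z => Φ (δ z)) (δ ⁻¹' V) :=
        hΦc.comp hδc.continuousOn (fun z hz => ⟨hδC z, hz⟩)
      exact hco 0 (by rw [Set.mem_preimage, hδz]; exact hV0)
    have h2 := (h1.continuousAt ev').norm
    apply h2.eventually_lt continuousAt_const
    rw [hδz, hΦ0, norm_zero]; positivity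
  obtain ⟨r', hr', hrb'⟩ := Metric.eventually_nhds_iff.1 (ev'.and ev2)
  simp only [dist_zero_right] at hrb'
  have hδV : ∀ z, ‖z‖ < r' → δ z ∈ curveCt ∩ V := fun z hz => ⟨hδC z, (hrb' hz).1⟩
  -- basic nonvanishing
  have hγne : ∀ t, t ≠ 0 → γ t ≠ 0 := fun t ht h => by
    have := congrArg (fun p : E2 => p 0) h
    simp only [γ0] at this
    exact ht (by simpa using this)
  have hFγne : ∀ t, t ≠ 0 → ‖t‖ < r → F (γ t) ≠ 0 := fun t ht htr h =>
    hγne t ht (hbij.injOn (hγU t htr) h0C (by rw [h, hF0]))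
  have hFγC : ∀ t, ‖t‖ < r → F (γ t) ∈ curveCt := fun t ht => (hbij.mapsTo (hγU t ht)).1
  have hFx : ∀ t, t ≠ 0 → ‖t‖ < r → F (γ t) 0 ≠ 0 := fun t ht htr =>
    curveCt_fst_ne (hFγC t htr) (hFγne t ht htr)
  let s : ℂ → ℂ := fun t => F (γ t) 1 / F (γ t) 0
  have hs2 : ∀ t, t ≠ 0 → ‖t‖ < r → s t ^ 2 = F (γ t) 0 := fun t ht htr => by
    have h1 : (F (γ t) 1) ^ 2 = (F (γ t) 0) ^ 3 := hFγC t htr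
    have h2 := hFx t ht htr
    simp only [s]
    rw [div_pow, h1]; field_simp
  have hs3 : ∀ t, t ≠ 0 → ‖t‖ < r → s t ^ 3 = F (γ t) 1 := fun t ht htr => by
    have h2 := hFx t ht htr
    rw [pow_succ, hs2 t ht htr]
    simp only [s]; field_simp
  have hs0 : ∀ t, t ≠ 0 → ‖t‖ < r → s t ≠ 0 := fun t ht htr h => by
    have := hs2 t ht htr
    rw [h] at this
    exact hFx t ht htr (by simpa using this.symm)
  have hFγc : ContinuousOn (fun t => F (γ t)) {t : ℂ | t ≠ 0 ∧ ‖t‖ < r} :=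
    hFc.comp hγc.continuousOn (fun t ht => hγU t ht.2)
  have hΦδne : ∀ z, z ≠ 0 → ‖z‖ < r' → Φ (δ z) ≠ 0 := fun z hz hzr h => by
    have h1 := hΦF _ (hδV z hzr)
    rw [h, hF0] at h1
    have := congrArg (fun p : E2 => p 0) h1.symm
    simp only [δ0] at this
    exact hz (by simpa using this)
  have hΦx : ∀ z, z ≠ 0 → ‖z‖ < r' → Φ (δ z) 0 ≠ 0 := fun z hz hzr =>
    curveC_fst_ne (hΦmem _ (hδV z hzr)).1 (hΦδne z hz hzr)
  have hΦδc : ContinuousOn (fun z => Φ (δ z)) {t : ℂ | t ≠ 0 ∧ ‖t‖ < r'} :=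
    hΦc.comp hδc.continuousOn (fun t ht => hδV t ht.2)
  let g : ℂ → ℂ := fun z => Φ (δ z) 1 / (Φ (δ z) 0) ^ 2
  have hg2 : ∀ z, z ≠ 0 → ‖z‖ < r' → g z ^ 2 = Φ (δ z) 0 := fun z hz hzr => by
    have h1 : (Φ (δ z) 1) ^ 2 = (Φ (δ z) 0) ^ 5 := (hΦmem _ (hδV z hzr)).1
    have h2 := hΦx z hz hzr
    simp only [g]
    rw [div_pow, h1]; field_simp
  have hg5 : ∀ z, z ≠ 0 → ‖z‖ < r' → g z ^ 5 = Φ (δ z) 1 := fun z hz hzr => by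
    have h2 := hΦx z hz hzr
    rw [show g z ^ 5 = (g z ^ 2) ^ 2 * g z by ring, hg2 z hz hzr]
    simp only [g]; field_simp
  have hγg : ∀ z, z ≠ 0 → ‖z‖ < r' → γ (g z) = Φ (δ z) := fun z hz hzr => by
    ext i
    fin_cases i
    · exact (γ0 _).trans (hg2 z hz hzr)
    · exact (γ1 _).trans (hg5 z hz hzr)
  refine core s g r r' hr hr' ?_ hs0 ?_ ?_ ?_ ?_ ?_
  · exact ((cont_coord 1).comp_continuousOn hFγc).div ((cont_coord 0).comp_continuousOn hFγc)
      (fun t ht => hFx t ht.1 ht.2)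
  · intro t ht htr
    have htr' : ‖-t‖ < r := by rwa [norm_neg]
    have ht' : -t ≠ 0 := neg_ne_zero.2 ht
    have hτ : 0 < ‖t‖ := norm_pos_iff.2 ht
    have hσ : 0 < ‖s t‖ := norm_pos_iff.2 (hs0 t ht htr)
    -- upper bound for the difference
    have hpq : ‖γ t - γ (-t)‖ ≤ 2 * ‖t‖ ^ 5 := by
      refine (e2_norm_le _).trans (le_of_eq ?_)
      rw [PiLp.sub_apply, PiLp.sub_apply, γ0, γ0, γ1, γ1,
        show t ^ 2 - (-t) ^ 2 = 0 by ring, show t ^ 5 - (-t) ^ 5 = 2 * t ^ 5 by ring]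
      simp
    have hdiff : ‖F (γ t) - F (γ (-t))‖ ≤ 2 * c * ‖t‖ ^ 4 := by
      refine (hH _ (hγU t htr) _ (hγU (-t) htr')).2.trans ?_
      calc c * ‖γ t - γ (-t)‖ ^ (4 / 5 : ℝ) ≤ c * (2 * ‖t‖ ^ 5) ^ (4 / 5 : ℝ) := by gcongr
        _ = c * (2 ^ (4 / 5 : ℝ) * ‖t‖ ^ 4) := by
          rw [Real.mul_rpow (by norm_num) (by positivity), ← Real.rpow_natCast ‖t‖ 5,
            ← Real.rpow_mul hτ.le, ← Real.rpow_natCast ‖t‖ 4]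
          norm_num
        _ ≤ c * (2 * ‖t‖ ^ 4) := by
          gcongr
          calc (2 : ℝ) ^ (4 / 5 : ℝ) ≤ 2 ^ (1 : ℝ) :=
                Real.rpow_le_rpow_of_exponent_le (by norm_num) (by norm_num)
            _ = 2 := Real.rpow_one 2
        _ = _ := by ring
    have hup : ‖F (γ t)‖ ≤ 1 := by
      have := (hH _ (hγU t htr) 0 h0C).2
      rw [hF0, sub_zero, sub_zero] at this
      exact this.trans (hrb htr).2.1.le
    have hs1 : ‖s t‖ ≤ 1 := by
      have h1 : ‖s t‖ ^ 2 ≤ 1 := by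
        rw [← norm_pow, hs2 t ht htr]
        exact (PiLp.norm_apply_le _ 0).trans hup
      nlinarith
    have hlow : 1 / c * (‖t‖ ^ 2) ^ (5 / 4 : ℝ) ≤ 2 * ‖s t‖ ^ 2 := by
      have h1 := (hH _ (hγU t htr) 0 h0C).1
      rw [hF0, sub_zero, sub_zero] at h1
      have h2 : ‖t‖ ^ 2 ≤ ‖γ t‖ := by
        have := PiLp.norm_apply_le (γ t) 0
        rwa [γ0, norm_pow] at this
      have h3 : ‖F (γ t)‖ ≤ ‖s t‖ ^ 2 + ‖s t‖ ^ 3 := by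
        have := e2_norm_le (F (γ t))
        rwa [← hs2 t ht htr, ← hs3 t ht htr, norm_pow, norm_pow] at this
      have h4 : ‖s t‖ ^ 3 ≤ ‖s t‖ ^ 2 := pow_le_pow_of_le_one hσ.le hs1 (by norm_num)
      calc 1 / c * (‖t‖ ^ 2) ^ (5 / 4 : ℝ) ≤ 1 / c * ‖γ t‖ ^ (5 / 4 : ℝ) := by gcongr
        _ ≤ _ := by linarith
    have hest := real_est c ‖t‖ ‖s t‖ _ hc hτ hσ (by positivity) (by
      rw [← Real.rpow_natCast, ← Real.rpow_mul (by positivity)]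
      norm_num
      ring) hlow (hrb htr).2.2.le
    refine ratio_re (s t) (s (-t)) (hs0 t ht htr) (2 * c * ‖t‖ ^ 4) ?_ ?_ hs1 hest
    · rw [hs2 t ht htr, hs2 _ ht' htr', ← PiLp.sub_apply]
      exact (PiLp.norm_apply_le _ 0).trans hdiff
    · rw [hs3 t ht htr, hs3 _ ht' htr', ← PiLp.sub_apply]
      exact (PiLp.norm_apply_le _ 1).trans hdiff
  · exact ((cont_coord 1).comp_continuousOn hΦδc).div
      (((cont_coord 0).comp_continuousOn hΦδc).pow 2)
      (fun t ht => pow_ne_zero 2 (hΦx t ht.1 ht.2))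
  · intro z hz hzr h
    have := hg2 z hz hzr
    rw [h] at this
    exact hΦx z hz hzr (by simpa using this.symm)
  · intro z hz hzr
    have h1 : ‖g z‖ ^ 2 < r ^ 2 := by
      rw [← norm_pow, hg2 z hz hzr]
      exact (PiLp.norm_apply_le _ 0).trans_lt (hrb' hzr).2
    exact lt_of_pow_lt_pow_left₀ 2 hr.le h1
  · intro z hz hzr
    simp only [s]
    rw [hγg z hz hzr, hΦF _ (hδV z hzr), δ0, δ1]
    field_simp
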